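/- Let T : C_r(L₁) → C_r(L₂) be an orthogonality preserving real-linear bijection (not assumed bounded). If F₂ has empty interior in L₂, then T is bi-orthogonality preserving; that is, the inverse map T⁻¹ : C_r(L₂) → C_r(L₁) is also orthogonality preserving. -/

import Mathlib

noncomputable section
set_option synthInstance.maxHeartbeats 1000000
set_option maxHeartbeats 1000000

/-- The real function algebra `C_r(L)` of continuous complex-valued functions on `L` that
take real values on the closed subset `F ⊆ L`, viewed as a real subalgebra of `C(L, ℂ)`
(with pointwise operations; the involution is pointwise conjugation and the norm is the sup
norm, both inherited from `C(L, ℂ)`). -/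
def Cr (L : Type*) [TopologicalSpace L] (F : Set L) : Subalgebra ℝ C(L, ℂ) where
  carrier := {f : C(L, ℂ) | ∀ t ∈ F, (f t).im = 0}
  mul_mem' := by
    intro f g hf hg t ht
    simp [Complex.mul_im, hf t ht, hg t ht]
  one_mem' := by intro t ht; simp
  add_mem' := by intro f g hf hg t ht; simp [hf t ht, hg t ht]
  zero_mem' := by intro t ht; simp
  algebraMap_mem' := by intro r t ht; simp

open Filter Topology

namespace Cr

variable {L : Type*} [TopologicalSpace L] {F : Set L}

lemma coe_mul_apply (f g : Cr L F) (x : L) : (f * g).1 x = f.1 x * g.1 x := rfl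

lemma mul_eq_zero_iff (f g : Cr L F) : f * g = 0 ↔ ∀ x, f.1 x = 0 ∨ g.1 x = 0 := by
  constructor
  · intro h x
    have := congrArg (fun k : Cr L F => k.1 x) h
    exact mul_eq_zero.1 this
  · intro h
    apply Subtype.ext
    ext x
    exact mul_eq_zero.2 (h x)

/-- Real-valued continuous functions, viewed as elements of `Cr L F`. -/
def ofReal (F : Set L) : C(L, ℝ) →+* Cr L F where
  toFun b := ⟨⟨fun x => (b x : ℂ), by fun_prop⟩, fun t _ => Complex.ofReal_im _⟩
  map_one' := by apply Subtype.ext; ext x; simp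
  map_mul' a b := by apply Subtype.ext; ext x; simp
  map_zero' := by apply Subtype.ext; ext x; simp
  map_add' a b := by apply Subtype.ext; ext x; simp

@[simp] lemma ofReal_apply (b : C(L, ℝ)) (x : L) : (ofReal F b).1 x = (b x : ℂ) := rfl

/-- Evaluation at a point as a real-linear map. -/
def eval (F : Set L) (x : L) : Cr L F →ₗ[ℝ] ℂ where
  toFun f := f.1 x
  map_add' _ _ := rfl
  map_smul' _ _ := rfl

@[simp] lemma eval_apply (f : Cr L F) (x : L) : eval F x f = f.1 x := rfl

lemma exists_bump [CompactSpace L] [T2Space L] {t : L} {N : Set L} (hN : N ∈ 𝓝 t) :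
    ∃ b : C(L, ℝ), (∀ᶠ x in 𝓝 t, b x = 1) ∧ (∀ x ∉ N, ∀ᶠ y in 𝓝 x, b y = 0) ∧
      ∀ x, b x ∈ Set.Icc (0 : ℝ) 1 := by
  obtain ⟨C, hC, hCc, hCN⟩ := exists_mem_nhds_isClosed_subset hN
  obtain ⟨D, hD, hDc, hDC⟩ := exists_mem_nhds_isClosed_subset (interior_mem_nhds.2 hC)
  obtain ⟨b, hb0, hb1, hb⟩ := exists_continuous_zero_one_of_isClosed
    (isOpen_interior (s := C)).isClosed_compl hDc
    (Set.disjoint_left.2 fun x hx hxD => hx (hDC hxD))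
  refine ⟨b, ?_, fun x hx => ?_, hb⟩
  · filter_upwards [hD] with x hx using hb1 hx
  · filter_upwards [hCc.isOpen_compl.mem_nhds fun h => hx (hCN h)] with y hy
    exact hb0 fun h => hy (interior_subset h)

lemma eval_surjective [CompactSpace L] [T2Space L] (hF : IsClosed F) {s : L} (hs : s ∉ F) :
    Function.Surjective (eval F s) := by
  intro z
  obtain ⟨b, hb1, hb0, -⟩ := exists_bump (hF.isOpen_compl.mem_nhds hs)
  refine ⟨⟨⟨fun x => (b x : ℂ) * z, by fun_prop⟩, fun t ht => ?_⟩, ?_⟩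
  · simp [(hb0 t (fun h => h ht)).self_of_nhds]
  · simp [hb1.self_of_nhds]

end Cr

lemma LinearMap.ker_eq_of_surjective_of_ker_le {K E V : Type*} [Field K] [AddCommGroup E]
    [Module K E] [AddCommGroup V] [Module K V] [FiniteDimensional K V] (α β : E →ₗ[K] V)
    (hβ : Function.Surjective β) (h : LinearMap.ker α ≤ LinearMap.ker β) :
    LinearMap.ker α = LinearMap.ker β := by
  refine le_antisymm h fun e he => ?_
  obtain ⟨r, hr⟩ := β.exists_rightInverse_of_surjective (LinearMap.range_eq_top.2 hβ)
  have hr' : ∀ v, β (r v) = v := fun v => LinearMap.congr_fun hr v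
  have hinj : Function.Injective (α ∘ₗ r) := by
    rw [← LinearMap.ker_eq_bot, LinearMap.ker_eq_bot']
    intro v hv
    rw [← hr' v]
    exact h hv
  obtain ⟨v, hv⟩ := (LinearMap.injective_iff_surjective.1 hinj) (α e)
  have h1 : β (e - r v) = 0 := h (by simpa [sub_eq_zero] using hv.symm)
  have hv0 : v = 0 := by
    rw [map_sub, LinearMap.mem_ker.1 he, hr', zero_sub, neg_eq_zero] at h1
    exact h1
  simpa [hv0] using hv.symm

section OrthogonalityPreserving

variable {L₁ L₂ : Type*}
    [TopologicalSpace L₁] [CompactSpace L₁] [T2Space L₁]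
    [TopologicalSpace L₂]
    {F₁ : Set L₁} {F₂ : Set L₂} {T : Cr L₁ F₁ →ₗ[ℝ] Cr L₂ F₂}

lemma exists_mem_support (hbij : Function.Bijective T)
    (hT : ∀ f g : Cr L₁ F₁, f * g = 0 → T f * T g = 0) (hint : interior F₂ = ∅)
    {V : Set L₁} (hV : IsOpen V) (hne : V.Nonempty) :
    ∃ s ∉ F₂, ∃ t ∈ V, ∀ h : Cr L₁ F₁, (∀ᶠ x in 𝓝 t, h.1 x = 0) → (T h).1 s = 0 := by
  obtain ⟨t₀, ht₀⟩ := hne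
  obtain ⟨b, hb1, hb0, -⟩ := Cr.exists_bump (hV.mem_nhds ht₀)
  have hTb : T (Cr.ofReal F₁ b) ≠ 0 := by
    rw [Ne, map_eq_zero_iff T hbij.1]
    intro h
    have := congrArg (fun k : Cr L₁ F₁ => k.1 t₀) h
    simp [hb1.self_of_nhds] at this
  obtain ⟨s, hsF, hs⟩ : ∃ s ∉ F₂, (T (Cr.ofReal F₁ b)).1 s ≠ 0 := by
    by_contra! hcon
    have hopen : IsOpen {s | (T (Cr.ofReal F₁ b)).1 s ≠ 0} :=
      isOpen_ne_fun (T (Cr.ofReal F₁ b)).1.continuous continuous_const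
    have hsub : {s | (T (Cr.ofReal F₁ b)).1 s ≠ 0} ⊆ interior F₂ :=
      interior_maximal (fun s hs => by_contra fun h => hs (hcon s h)) hopen
    rw [hint] at hsub
    apply hTb
    apply Subtype.ext
    ext s
    by_contra h
    exact hsub h
  refine ⟨s, hsF, ?_⟩
  by_contra! hcon
  have hall : ∀ t, ∃ h : Cr L₁ F₁, (∀ᶠ x in 𝓝 t, h.1 x = 0) ∧ (T h).1 s ≠ 0 := by
    intro t
    by_cases ht : t ∈ V
    · exact hcon t ht
    · refine ⟨_, ?_, hs⟩
      filter_upwards [hb0 t ht] with x hx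
      simp [hx]
  let J : Ideal C(L₁, ℝ) :=
    { carrier := {k | ∀ m, (T (Cr.ofReal F₁ k * m)).1 s = 0}
      add_mem' := by
        intro a c ha hc m
        have : (T (Cr.ofReal F₁ (a + c) * m)).1 s =
            (T (Cr.ofReal F₁ a * m)).1 s + (T (Cr.ofReal F₁ c * m)).1 s := by
          rw [map_add, add_mul, map_add]; rfl
        rw [this, ha m, hc m, add_zero]
      zero_mem' := by
        intro m
        rw [map_zero, zero_mul, map_zero]; rfl
      smul_mem' := by
        intro c k hk m
        rw [smul_eq_mul, mul_comm c k, map_mul (Cr.ofReal F₁), mul_assoc]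
        exact hk _ }
  have hJ : J ≠ ⊤ := by
    rw [Ne, Ideal.eq_top_iff_one]
    intro h
    have := h (Cr.ofReal F₁ b)
    rw [map_one, one_mul] at this
    exact hs this
  obtain ⟨M, hM, hJM⟩ := J.exists_le_maximal hJ
  obtain ⟨t, ht⟩ := ContinuousMap.setOfIdeal_eq_compl_singleton M
  have htM : ∀ k ∈ M, k t = 0 := fun k hk =>
    ContinuousMap.notMem_setOfIdeal.1 (by rw [ht]; simp) hk
  obtain ⟨h, hh0, hh⟩ := hall t
  obtain ⟨c, hc1, hc0, -⟩ := Cr.exists_bump hh0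
  have hcJ : c ∈ J := by
    intro m
    have horth := hT (Cr.ofReal F₁ c * m) h ((Cr.mul_eq_zero_iff _ _).2 fun x => by
      by_cases hx : h.1 x = 0
      · exact Or.inr hx
      · left
        rw [Cr.coe_mul_apply, Cr.ofReal_apply, (hc0 x hx).self_of_nhds]
        simp)
    exact ((Cr.mul_eq_zero_iff _ _).1 horth s).resolve_right hh
  have := htM c (hJM hcJ)
  rw [hc1.self_of_nhds] at this
  exact one_ne_zero this

lemma exists_ker_eval_le [CompactSpace L₂] (hbij : Function.Bijective T)
    (hT : ∀ f g : Cr L₁ F₁, f * g = 0 → T f * T g = 0) (hint : interior F₂ = ∅)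
    {U : Set L₁} (hU : IsOpen U) (hne : U.Nonempty) :
    ∃ s ∉ F₂, ∃ t ∈ U, ∀ h : Cr L₁ F₁, h.1 t = 0 → (T h).1 s = 0 := by
  by_contra! hcon
  have hinf : U.Infinite := by
    intro hfin
    obtain ⟨s, hs, t, ht, hst⟩ := exists_mem_support hbij hT hint hU hne
    obtain ⟨h, h0, h1⟩ := hcon s hs t ht
    refine h1 (hst h ?_)
    have hcl : IsClosed (U \ {t}) := (hfin.subset Set.sdiff_subset).isClosed
    filter_upwards [hU.mem_nhds ht, hcl.isOpen_compl.mem_nhds (by simp)] with x hx hx'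
    have : x = t := by
      by_contra hxt
      exact hx' ⟨hx, hxt⟩
    rwa [this]
  have := hinf.to_subtype
  obtain ⟨W, hWi, hWo, hWd⟩ := exists_seq_infinite_isOpen_pairwise_disjoint U
  let V : ℕ → Set L₁ := fun n => Set.image Subtype.val (W n)
  have hVU : ∀ n, V n ⊆ U := by
    rintro n _ ⟨x, -, rfl⟩
    exact x.2
  have hVo : ∀ n, IsOpen (V n) := fun n => hU.isOpenMap_subtype_val _ (hWo n)
  have hVd : ∀ x m n, x ∈ V m → x ∈ V n → m = n := by
    rintro _ m n ⟨x, hx, rfl⟩ ⟨y, hy, hxy⟩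
    obtain rfl : y = x := Subtype.ext hxy
    by_contra hmn
    exact Set.disjoint_left.1 (hWd hmn) hx hy
  have hVne : ∀ n, (V n).Nonempty := fun n => (hWi n).nonempty.image _
  choose s hs t ht hst using fun n => exists_mem_support hbij hT hint (hVo n) (hVne n)
  choose h h0 h1 using fun n => hcon (s n) (hs n) (t n) (hVU n (ht n))
  have hk : ∀ n : ℕ, ∃ k : Cr L₁ F₁, (∀ x ∉ V n, k.1 x = 0) ∧ ‖k.1‖ ≤ (1 / 2 : ℝ) ^ n ∧
      ‖(T k).1 (s n)‖ = n := by
    intro n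
    set g : Cr L₁ F₁ := ((n : ℝ) / ‖(T (h n)).1 (s n)‖) • h n with hg
    have hTg : ‖(T g).1 (s n)‖ = n := by
      have : (T g).1 (s n) = ((n : ℝ) / ‖(T (h n)).1 (s n)‖) • (T (h n)).1 (s n) := by
        rw [hg, map_smul]; rfl
      rw [this, norm_smul, norm_div, norm_norm, div_mul_cancel₀ _ (norm_ne_zero_iff.2 (h1 n))]
      simp
    have hgt : g.1 (t n) = 0 := by
      have : g.1 (t n) = ((n : ℝ) / ‖(T (h n)).1 (s n)‖) • (h n).1 (t n) := rfl
      rw [this, h0, smul_zero]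
    have hsmall : ∀ᶠ x in 𝓝 (t n), ‖g.1 x‖ < (1 / 2 : ℝ) ^ n := by
      refine (g.1.continuous.norm.continuousAt (x := t n)).eventually_lt
        continuousAt_const ?_
      rw [hgt, norm_zero]
      positivity
    obtain ⟨b, hb1, hb0, hb⟩ := Cr.exists_bump
      (hsmall.and ((hVo n).mem_nhds (ht n)) : {x | _ ∧ x ∈ V n} ∈ 𝓝 (t n))
    refine ⟨Cr.ofReal F₁ b * g, fun x hx => ?_, ?_, ?_⟩
    · rw [Cr.coe_mul_apply, Cr.ofReal_apply, (hb0 x fun h => hx h.2).self_of_nhds]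
      simp
    · rw [ContinuousMap.norm_le _ (by positivity)]
      intro x
      rw [Cr.coe_mul_apply, Cr.ofReal_apply, norm_mul, Complex.norm_real]
      by_cases hx : ‖g.1 x‖ < (1 / 2 : ℝ) ^ n ∧ x ∈ V n
      · rw [Real.norm_of_nonneg (hb x).1]
        nlinarith [(hb x).1, (hb x).2, norm_nonneg (g.1 x), hx.1]
      · rw [(hb0 x hx).self_of_nhds]
        simp
    · have hz := hst n (Cr.ofReal F₁ b * g - g) (by
        filter_upwards [hb1] with x hx
        have : (Cr.ofReal F₁ b * g - g).1 x = (b x : ℂ) * g.1 x - g.1 x := rfl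
        rw [this, hx]
        simp)
      have hz' : (T (Cr.ofReal F₁ b * g)).1 (s n) - (T g).1 (s n) = 0 := by
        rw [map_sub] at hz
        exact hz
      rw [sub_eq_zero.1 hz', hTg]
  choose k hk0 hkn hkT using hk
  have hsum : Summable fun n => (k n).1 :=
    Summable.of_norm_bounded (summable_geometric_of_lt_one (by norm_num) (by norm_num)) hkn
  have hKx : ∀ x, HasSum (fun n => (k n).1 x) ((∑' n, (k n).1) x) := fun x =>
    ContinuousMap.hasSum_apply hsum.hasSum x
  let K : Cr L₁ F₁ := ⟨∑' n, (k n).1, fun x hx => by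
    have := Complex.hasSum_im (hKx x)
    simp only [(k _).2 x hx] at this
    exact this.unique hasSum_zero⟩
  have hKV : ∀ n, ∀ x ∈ V n, K.1 x = (k n).1 x := fun n x hx =>
    (hKx x).unique (hasSum_single n fun m hm => hk0 m x fun hxm => hm (hVd x m n hxm hx))
  have hTK : ∀ n : ℕ, (n : ℝ) ≤ ‖(T K).1‖ := by
    intro n
    have hz := hst n (K - k n) (by
      filter_upwards [(hVo n).mem_nhds (ht n)] with x hx
      exact sub_eq_zero.2 (hKV n x hx))
    rw [map_sub] at hz
    have hz' : (T K).1 (s n) = (T (k n)).1 (s n) := sub_eq_zero.1 hz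
    rw [← hkT n, ← hz']
    exact (T K).1.norm_coe_le_norm _
  obtain ⟨n, hn⟩ := exists_nat_gt ‖(T K).1‖
  exact absurd (hTK n) (not_le.2 hn)

end OrthogonalityPreserving

/-- If `T : C_r(L₁) → C_r(L₂)` is an orthogonality preserving real-linear
bijection (not assumed bounded) and `F₂` has empty interior in `L₂`, then `T` is
bi-orthogonality preserving, i.e. the inverse map is also orthogonality preserving. -/
theorem stmt_7 {L₁ L₂ : Type*}
    [TopologicalSpace L₁] [CompactSpace L₁] [T2Space L₁]
    [TopologicalSpace L₂] [CompactSpace L₂] [T2Space L₂]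
    (F₁ : Set L₁) (F₂ : Set L₂) (hF₁ : IsClosed F₁) (hF₂ : IsClosed F₂)
    (T : Cr L₁ F₁ →ₗ[ℝ] Cr L₂ F₂) (hbij : Function.Bijective T)
    (hT : ∀ f g : Cr L₁ F₁, f * g = 0 → T f * T g = 0)
    (hint : interior F₂ = ∅) :
    ∀ f g : Cr L₁ F₁, T f * T g = 0 → f * g = 0 := by
  intro f g hfg
  by_contra hne
  have hU : {x | (f * g).1 x ≠ 0}.Nonempty := by
    by_contra hemp
    apply hne
    apply Subtype.ext
    ext x
    by_contra hx
    exact hemp ⟨x, hx⟩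
  obtain ⟨s, hs, t, ht, hst⟩ := exists_ker_eval_le hbij hT hint
    (isOpen_ne_fun (f * g).1.continuous continuous_const) hU
  have hsurj : Function.Surjective (Cr.eval F₂ s ∘ₗ T) :=
    (Cr.eval_surjective hF₂ hs).comp hbij.2
  have hker := LinearMap.ker_eq_of_surjective_of_ker_le (Cr.eval F₁ t) (Cr.eval F₂ s ∘ₗ T)
    hsurj fun h hh => hst h hh
  have hzero : ∀ h : Cr L₁ F₁, (T h).1 s = 0 → h.1 t = 0 := fun h hh => by
    have : h ∈ LinearMap.ker (Cr.eval F₂ s ∘ₗ T) := hh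
    rw [← hker] at this
    exact this
  apply ht
  rw [Cr.coe_mul_apply]
  rcases (Cr.mul_eq_zero_iff _ _).1 hfg s with h | h
  · rw [hzero f h, zero_mul]
  · rw [hzero g h, mul_zero]
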